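/- Let X be a Banach space admitting an equivalent asymptotically uniformly convex norm. Then C(X) ≤ ω (i.e., for every ε > 0 there exists n ∈ ω with γ_ε^n(B_X) = ∅) and X has the Slice Point of Continuity Property. -/

import Mathlib

open Metric Set Topology

noncomputable section

/-- Transfinite iteration of a derivation `d` starting from `a`;
meets are taken at limit stages. -/
def derivIter {L : Type*} [CompleteLattice L] (d : L → L) (a : L) (α : Ordinal) : L :=
  Ordinal.limitRecOn α a (fun _ ih => d ih) (fun o _ ih => ⨅ (γ : Ordinal) (h : γ < o), ih γ h)

/-- The weak topology of a real normed space. -/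
def weakTop (X : Type*) [NormedAddCommGroup X] [NormedSpace ℝ X] : TopologicalSpace X :=
  TopologicalSpace.induced (fun (x : X) (f : X →L[ℝ] ℝ) => f x) inferInstance

variable {X : Type*} [NormedAddCommGroup X] [NormedSpace ℝ X]

/-- The dentability derivation `d_ε^1`. -/
def dentDeriv (ε : ℝ) (C : Set X) : Set X :=
  C \ ⋃ (f : X →L[ℝ] ℝ) (a : ℝ) (_ : Metric.diam ({y | a < f y} ∩ C) < ε), {y | a < f y}

/-- The weak fragmentation derivation `σ_ε^1`. -/
def weakDeriv (ε : ℝ) (C : Set X) : Set X :=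
  C \ ⋃ (V : Set X) (_ : IsOpen[weakTop X] V) (_ : Metric.diam (V ∩ C) < ε), V

/-- The convex weak fragmentation derivation `γ_ε^1`. -/
def convDeriv (ε : ℝ) (C : Set X) : Set X :=
  closure (convexHull ℝ (weakDeriv ε C))

/-- `treeRoot C δ α x` : `x` is the root of a `δ`-`α`-tree contained in `C`. -/
def treeRoot (C : Set X) (δ : ℝ) (α : Ordinal) : X → Prop :=
  Ordinal.limitRecOn α (fun x => x ∈ C)
    (fun _ ih x => x ∈ C ∧ ∃ y z : X,
      x = (2⁻¹ : ℝ) • (y + z) ∧ δ ≤ 2⁻¹ * ‖y - z‖ ∧ ih y ∧ ih z)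
    (fun o _ ih x => ∀ γ (h : γ < o), ih γ h x)

/-- `sprawlRoot C δ α x` : `x` is the root of a `δ`-`α`-sprawling tree contained in `C`. -/
def sprawlRoot (C : Set X) (δ : ℝ) (α : Ordinal) : X → Prop :=
  Ordinal.limitRecOn α (fun x => x ∈ C)
    (fun _ ih x => x ∈ C ∧ ∃ y z : ℕ → X,
      (∀ n, x = (2⁻¹ : ℝ) • (y n + z n)) ∧
      (∀ n m, n ≠ m → δ ≤ ‖y n - y m‖) ∧
      (∀ n, ih (y n)) ∧ (∀ n, ih (z n)))
    (fun o _ ih x => ∀ γ (h : γ < o), ih γ h x)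

/-- `bushRoot C δ α x` : `x` is the root of a `δ`-`α`-bush contained in `C`. -/
def bushRoot (C : Set X) (δ : ℝ) (α : Ordinal) : X → Prop :=
  Ordinal.limitRecOn α (fun x => x ∈ C)
    (fun _ ih x => x ∈ C ∧ ∃ (n : ℕ) (y : Fin (n + 1) → X) (lam : Fin (n + 1) → ℝ),
      (∀ i, 0 < lam i ∧ lam i ≤ 1) ∧ (∑ i, lam i = 1) ∧
      x = ∑ i, lam i • y i ∧ (∀ i, δ ≤ ‖x - y i‖) ∧ ∀ i, ih (y i))
    (fun o _ ih x => ∀ γ (h : γ < o), ih γ h x)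

/-- `X` has the Slice Point of Continuity Property. -/
def SlicePCP (X : Type*) [NormedAddCommGroup X] [NormedSpace ℝ X] : Prop :=
  ∀ A : Set X, A.Nonempty → Bornology.IsBounded A → ∀ ε > (0 : ℝ),
    ∃ (f : X →L[ℝ] ℝ) (a : ℝ), ({y | a < f y} ∩ A).Nonempty ∧
      ∀ x ∈ {y | a < f y} ∩ A, ∃ V ∈ @nhds X (weakTop X) x, Metric.diam (V ∩ A) < ε

/-- The norm of `Y` is asymptotically uniformly convex (AUC). -/
def IsAUCNorm (Y : Type*) [NormedAddCommGroup Y] [NormedSpace ℝ Y] : Prop :=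
  ∀ ε > (0 : ℝ), ∃ δ > (0 : ℝ), ∀ y : Y, 1 - δ < ‖y‖ →
    ∃ V ∈ @nhds Y (weakTop Y) y, Metric.diam (V ∩ Metric.closedBall (0 : Y) 1) < ε

theorem derivIter_zero {L : Type*} [CompleteLattice L] (d : L → L) (a : L) :
    derivIter d a 0 = a :=
  Ordinal.limitRecOn_zero _ _ _

theorem derivIter_add_one {L : Type*} [CompleteLattice L] (d : L → L) (a : L) (α : Ordinal) :
    derivIter d a (α + 1) = d (derivIter d a α) :=
  Ordinal.limitRecOn_add_one ..

/-- A bounded linear map is weak-to-weak continuous. -/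
theorem preimage_mem_nhds_weakTop {X Y : Type*} [NormedAddCommGroup X] [NormedSpace ℝ X]
    [NormedAddCommGroup Y] [NormedSpace ℝ Y] (T : X →L[ℝ] Y) (x : X) {V : Set Y}
    (hV : V ∈ @nhds Y (weakTop Y) (T x)) : T ⁻¹' V ∈ @nhds X (weakTop X) x := by
  have h : @Continuous X Y (weakTop X) (weakTop Y) T := by
    have hP : Continuous fun (φ : (X →L[ℝ] ℝ) → ℝ) (f : Y →L[ℝ] ℝ) => φ (f.comp T) :=
      continuous_pi fun f => continuous_apply (f.comp T)
    rw [continuous_iff_le_induced, weakTop, weakTop, induced_compose]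
    refine (induced_mono hP.le_induced).trans_eq ?_
    rw [induced_compose]
    rfl
  exact @Continuous.tendsto X Y (weakTop X) (weakTop Y) T h x _ hV

/-- The preimage of a closed ball under an isomorphism. -/
def preBall {X Y : Type*} [NormedAddCommGroup X] [NormedSpace ℝ X]
    [NormedAddCommGroup Y] [NormedSpace ℝ Y] (e : X ≃L[ℝ] Y) (r : ℝ) : Set X :=
  {x | ‖e x‖ ≤ r}

section

variable {X Y : Type*} [NormedAddCommGroup X] [NormedSpace ℝ X]
  [NormedAddCommGroup Y] [NormedSpace ℝ Y]

theorem dist_le_of_equiv (e : X ≃L[ℝ] Y) (u v : X) :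
    dist u v ≤ ‖(e.symm : Y →L[ℝ] X)‖ * ‖e u - e v‖ := by
  simpa [dist_eq_norm] using (e.symm : Y →L[ℝ] X).le_opNorm (e u - e v)

theorem diam_preBall_le (e : X ≃L[ℝ] Y) {r : ℝ} (hr : 0 ≤ r) :
    diam (preBall e r) ≤ ‖(e.symm : Y →L[ℝ] X)‖ * (2 * r) := by
  refine diam_le_of_forall_dist_le (by positivity) fun u hu v hv => ?_
  refine (dist_le_of_equiv e u v).trans ?_
  gcongr
  exact (norm_sub_le _ _).trans (by rw [two_mul]; exact add_le_add hu hv)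

theorem isBounded_preBall (e : X ≃L[ℝ] Y) (r : ℝ) : Bornology.IsBounded (preBall e r) := by
  refine isBounded_iff.2 ⟨‖(e.symm : Y →L[ℝ] X)‖ * (r + r), fun u hu v hv => ?_⟩
  refine (dist_le_of_equiv e u v).trans ?_
  gcongr
  exact (norm_sub_le _ _).trans (add_le_add hu hv)

theorem convex_preBall (e : X ≃L[ℝ] Y) (r : ℝ) : Convex ℝ (preBall e r) := by
  have h : preBall e r = e ⁻¹' closedBall 0 r := by ext x; simp [preBall]
  rw [h]
  exact (convex_closedBall (0 : Y) r).linear_preimage (e : X →L[ℝ] Y).toLinearMap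

theorem isClosed_preBall (e : X ≃L[ℝ] Y) (r : ℝ) : IsClosed (preBall e r) :=
  isClosed_le e.continuous.norm continuous_const

theorem exists_subset_preBall (e : X ≃L[ℝ] Y) {A : Set X} (hA : Bornology.IsBounded A) :
    ∃ R > 0, A ⊆ preBall e R := by
  obtain ⟨R, hR, h⟩ := hA.exists_pos_norm_le
  refine ⟨‖(e : X →L[ℝ] Y)‖ * R + 1, by positivity, fun x hx => ?_⟩
  have h1 : ‖e x‖ ≤ ‖(e : X →L[ℝ] Y)‖ * ‖x‖ := (e : X →L[ℝ] Y).le_opNorm x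
  have h2 : ‖(e : X →L[ℝ] Y)‖ * ‖x‖ ≤ ‖(e : X →L[ℝ] Y)‖ * R := by gcongr; exact h x hx
  change ‖e x‖ ≤ _
  linarith

/-- The AUC estimate, transported to `X` and rescaled uniformly to balls of radius at most `R`. -/
theorem IsAUCNorm.exists_preBall (hY : IsAUCNorm Y) (e : X ≃L[ℝ] Y) {ε R : ℝ} (hε : 0 < ε)
    (hR : 0 < R) :
    ∃ δ > 0, δ < 1 ∧ ∀ r, 0 < r → r ≤ R → ∀ x, (1 - δ) * r < ‖e x‖ →
      ∃ V ∈ @nhds X (weakTop X) x, diam (V ∩ preBall e r) < ε := by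
  set K := ‖(e.symm : Y →L[ℝ] X)‖
  have hK : 0 ≤ K := norm_nonneg _
  have hKR : 0 < K * R + 1 := by positivity
  obtain ⟨δ, hδ, H⟩ := hY (ε / 2 / (K * R + 1)) (by positivity)
  refine ⟨min δ (1 / 2), by positivity, (min_le_right _ _).trans_lt (by norm_num),
    fun r hr hrR x hx => ?_⟩
  let T : X →L[ℝ] Y := r⁻¹ • (e : X →L[ℝ] Y)
  have hT : ∀ u, T u = r⁻¹ • e u := fun u => rfl
  have hTn : ∀ u, ‖T u‖ = ‖e u‖ / r := fun u => by
    rw [hT, norm_smul, norm_inv, Real.norm_of_nonneg hr.le, inv_mul_eq_div]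
  obtain ⟨V, hV, hd⟩ := H (T x) (by
    rw [hTn, lt_div_iff₀ hr]
    refine lt_of_le_of_lt ?_ hx
    gcongr
    exact min_le_left _ _)
  refine ⟨T ⁻¹' V, preimage_mem_nhds_weakTop T x hV, ?_⟩
  refine lt_of_le_of_lt ?_ (half_lt_self hε)
  have hmem : ∀ u ∈ T ⁻¹' V ∩ preBall e r, T u ∈ V ∩ closedBall 0 1 := fun u hu =>
    ⟨hu.1, by rw [mem_closedBall_zero_iff, hTn, div_le_one hr]; exact hu.2⟩
  refine diam_le_of_forall_dist_le (by positivity) fun u hu v hv => ?_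
  have h1 := (dist_le_diam_of_mem (isBounded_closedBall.subset inter_subset_right)
    (hmem u hu) (hmem v hv)).trans hd.le
  have h2 : ‖e u - e v‖ = r * dist (T u) (T v) := by
    rw [dist_eq_norm, hT, hT, ← smul_sub, norm_smul, norm_inv, Real.norm_of_nonneg hr.le,
      mul_inv_cancel_left₀ hr.ne']
  calc dist u v ≤ K * ‖e u - e v‖ := dist_le_of_equiv e u v
    _ = K * (r * dist (T u) (T v)) := by rw [h2]
    _ ≤ K * (R * (ε / 2 / (K * R + 1))) := by gcongr
    _ = (K * R) * (ε / 2 / (K * R + 1)) := by ring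
    _ ≤ (K * R + 1) * (ε / 2 / (K * R + 1)) := by gcongr; linarith
    _ = ε / 2 := by field_simp

theorem weakDeriv_mono {ε : ℝ} {C D : Set X} (hCD : C ⊆ D) (hD : Bornology.IsBounded D) :
    weakDeriv ε C ⊆ weakDeriv ε D := by
  rintro x ⟨hx, hn⟩
  refine ⟨hCD hx, fun h => hn ?_⟩
  simp only [mem_iUnion] at h ⊢
  obtain ⟨V, hV, hd, hxV⟩ := h
  exact ⟨V, hV, (diam_mono (inter_subset_inter_right V hCD)
    (hD.subset inter_subset_right)).trans_lt hd, hxV⟩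

theorem convDeriv_mono {ε : ℝ} {C D : Set X} (hCD : C ⊆ D) (hD : Bornology.IsBounded D) :
    convDeriv ε C ⊆ convDeriv ε D :=
  closure_mono (convexHull_mono (weakDeriv_mono hCD hD))

theorem notMem_weakDeriv {ε : ℝ} {C V : Set X} {x : X} (hC : Bornology.IsBounded C)
    (hV : V ∈ @nhds X (weakTop X) x) (hd : diam (V ∩ C) < ε) : x ∉ weakDeriv ε C := by
  rintro ⟨-, hn⟩
  obtain ⟨U, hUV, hU, hxU⟩ := (@_root_.mem_nhds_iff X (weakTop X) x V).1 hV
  refine hn ?_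
  simp only [mem_iUnion]
  exact ⟨U, hU, (diam_mono (inter_subset_inter_left C hUV)
    (hC.subset inter_subset_right)).trans_lt hd, hxU⟩

theorem convDeriv_eq_empty {ε : ℝ} {C : Set X} (hC : Bornology.IsBounded C) (hd : diam C < ε) :
    convDeriv ε C = ∅ := by
  have h : weakDeriv ε C = ∅ := eq_empty_of_forall_notMem fun x =>
    notMem_weakDeriv hC (@Filter.univ_mem X (@nhds X (weakTop X) x)) (by rwa [univ_inter])
  rw [convDeriv, h, convexHull_empty, closure_empty]

theorem IsAUCNorm.exists_derivIter_eq_empty (hY : IsAUCNorm Y) (e : X ≃L[ℝ] Y) {C : Set X}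
    (hC : Bornology.IsBounded C) {ε : ℝ} (hε : 0 < ε) :
    ∃ n : ℕ, derivIter (convDeriv ε) C (n : Ordinal) = ∅ := by
  obtain ⟨R, hR, hCR⟩ := exists_subset_preBall e hC
  obtain ⟨δ, hδ, hδ1, H⟩ := hY.exists_preBall e hε hR
  have hq : 0 < 1 - δ := by linarith
  have hpow : ∀ n : ℕ, derivIter (convDeriv ε) C (n : Ordinal) ⊆ preBall e ((1 - δ) ^ n * R) := by
    intro n
    induction n with
    | zero => simpa [derivIter_zero] using hCR
    | succ n ih =>
      rw [Nat.cast_succ, derivIter_add_one]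
      refine (convDeriv_mono ih (isBounded_preBall e _)).trans
        (closure_minimal (convexHull_min (fun x hx => ?_) (convex_preBall e _))
          (isClosed_preBall e _))
      by_contra hlt
      have hlt' : (1 - δ) ^ (n + 1) * R < ‖e x‖ := not_le.1 hlt
      obtain ⟨V, hV, hd⟩ := H ((1 - δ) ^ n * R) (by positivity)
        (mul_le_of_le_one_left hR.le (pow_le_one₀ hq.le (by linarith))) x
        (by rwa [← mul_assoc, ← pow_succ'])
      exact notMem_weakDeriv (isBounded_preBall e _) hV hd hx
  set K := ‖(e.symm : Y →L[ℝ] X)‖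
  have hK : 0 ≤ K := norm_nonneg _
  obtain ⟨n, hn⟩ := exists_pow_lt_of_lt_one (show 0 < ε / (K * (2 * R) + 1) by positivity)
    (show 1 - δ < 1 by linarith)
  refine ⟨n + 1, ?_⟩
  rw [Nat.cast_succ, derivIter_add_one]
  refine subset_empty_iff.1 ((convDeriv_mono (hpow n) (isBounded_preBall e _)).trans_eq
    (convDeriv_eq_empty (isBounded_preBall e _) ?_))
  refine (diam_preBall_le e (by positivity)).trans_lt ?_
  rw [lt_div_iff₀ (by positivity)] at hn
  have : 0 < (1 - δ) ^ n := by positivity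
  change K * (2 * ((1 - δ) ^ n * R)) < ε
  nlinarith

theorem IsAUCNorm.slicePCP (hY : IsAUCNorm Y) (e : X ≃L[ℝ] Y) : SlicePCP X := by
  intro A hne hA ε hε
  obtain ⟨R, hR, hAR⟩ := exists_subset_preBall e hA
  obtain ⟨δ, hδ, hδ1, H⟩ := hY.exists_preBall e hε hR
  have hbdd : BddAbove ((fun x => ‖e x‖) '' A) := ⟨R, forall_mem_image.2 hAR⟩
  set r := sSup ((fun x => ‖e x‖) '' A)
  have hr : ∀ x ∈ A, ‖e x‖ ≤ r := fun x hx => le_csSup hbdd (mem_image_of_mem _ hx)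
  have hr0 : 0 ≤ r := (norm_nonneg _).trans (hr _ hne.some_mem)
  have hrR : r ≤ R := csSup_le (hne.image _) (forall_mem_image.2 hAR)
  rcases hr0.eq_or_lt with h0 | hpos
  · refine ⟨0, -1, by simpa using hne, fun x _ => ⟨univ, Filter.univ_mem, ?_⟩⟩
    have hsub : A ⊆ {0} := fun x hx => by simpa [← h0] using hr x hx
    rw [univ_inter, diam_subsingleton (subsingleton_singleton.anti hsub)]
    exact hε
  · obtain ⟨_, ⟨x, hx, rfl⟩, hlt⟩ := exists_lt_of_lt_csSup (hne.image _)
      (show (1 - δ) * r < r by nlinarith)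
    obtain ⟨g, hg, hgx⟩ := exists_dual_vector'' ℝ (e x)
    refine ⟨g.comp (e : X →L[ℝ] Y), (1 - δ) * r, ⟨x, ?_, hx⟩, fun y hy => ?_⟩
    · simpa [hgx] using hlt
    · have h1 : (1 - δ) * r < g (e y) := hy.1
      have h2 : g (e y) ≤ ‖e y‖ :=
        (le_abs_self _).trans ((g.le_opNorm _).trans
          (mul_le_of_le_one_left (norm_nonneg _) hg))
      obtain ⟨V, hV, hd⟩ := H r hpos hrR y (h1.trans_le h2)
      exact ⟨V, hV, (diam_mono (inter_subset_inter_right V hr)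
        ((isBounded_preBall e r).subset inter_subset_right)).trans_lt hd⟩

end

/-- If `X` admits an equivalent AUC norm (i.e. `X` is linearly isomorphic to a
Banach space `Y` whose norm is AUC), then `C(X) ≤ ω` (for every `ε > 0` some finite iterate of
the convex weak fragmentation derivation of `B_X` is empty) and `X` has the Slice PCP. -/
theorem statement4 {X Y : Type*} [NormedAddCommGroup X] [NormedSpace ℝ X] [CompleteSpace X]
    [NormedAddCommGroup Y] [NormedSpace ℝ Y]
    (e : X ≃L[ℝ] Y) (hY : IsAUCNorm Y) :
    (∀ ε > (0 : ℝ), ∃ n : ℕ,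
        derivIter (convDeriv ε) (Metric.closedBall (0 : X) 1) (n : Ordinal) = ∅) ∧
      SlicePCP X := by
  exact ⟨fun ε hε => hY.exists_derivIter_eq_empty e isBounded_closedBall hε, hY.slicePCP e⟩
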